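/- Let Q ∈ ℂ^{n×n} be a unitary matrix whose first column equals 1ₙ/√n, and write Q = [1ₙ/√n, Q₂] with Q₂ ∈ ℂ^{n×(n−1)}. Then for every A₂₂ ∈ ℂ^{(m−1)×(m−1)} and A₂₁ ∈ ℂ^{m−1}: ‖A₂₂ X₂ + A₂₁ 1ₙᴴ − Y₂‖_F² = n · ‖A₂₂ μ_X + A₂₁ − μ_Y‖₂² + ‖(A₂₂ X₂ − Y₂) Q₂‖_F². (Decoupling identity used in the proof of the Affine DMD proposition.) -/

import Mathlib

open Matrix

/-- Squared Frobenius norm of a complex matrix. -/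
noncomputable def frobSq {m n : ℕ} (A : Matrix (Fin m) (Fin n) ℂ) : ℝ :=
  ∑ i, ∑ j, ‖A i j‖ ^ 2

theorem ofReal_frobSq {m n : ℕ} (A : Matrix (Fin m) (Fin n) ℂ) :
    (frobSq A : ℂ) = (A * Aᴴ).trace := by
  simp [frobSq, Matrix.trace, Matrix.mul_apply, Complex.mul_conj']

theorem frobSq_mul_unitary {m n : ℕ} (A : Matrix (Fin m) (Fin n) ℂ)
    {Q : Matrix (Fin n) (Fin n) ℂ} (hQ : Q ∈ Matrix.unitaryGroup (Fin n) ℂ) :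
    frobSq (A * Q) = frobSq A := by
  have hQQ : Q * Qᴴ = 1 := Matrix.mem_unitaryGroup_iff.mp hQ
  apply Complex.ofReal_injective
  rw [ofReal_frobSq, ofReal_frobSq, conjTranspose_mul, Matrix.mul_assoc A Q,
    ← Matrix.mul_assoc Q, hQQ, Matrix.one_mul]

/-- If the first column of a unitary matrix is a nonzero constant, every other column sums to
zero. -/
theorem sum_column_succ_eq_zero {n : ℕ} {Q : Matrix (Fin (n + 1)) (Fin (n + 1)) ℂ}
    (hQ : Q ∈ Matrix.unitaryGroup (Fin (n + 1)) ℂ) {c : ℂ} (hc : c ≠ 0)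
    (hQ1 : ∀ i, Q i 0 = c) (j : Fin n) : ∑ k, Q k j.succ = 0 := by
  have hQQ : Qᴴ * Q = 1 := Matrix.mem_unitaryGroup_iff'.mp hQ
  have h := congrFun (congrFun hQQ 0) j.succ
  rw [Matrix.mul_apply, Matrix.one_apply_ne (Fin.succ_ne_zero j).symm] at h
  simp only [conjTranspose_apply, hQ1, ← Finset.mul_sum] at h
  exact (mul_eq_zero.mp h).resolve_left (star_ne_zero.mpr hc)

/-- Decoupling identity used in the proof of the Affine DMD proposition.  Here the
number of samples is `n + 1`; `Q = [1/√(n+1), Q₂]` is unitary with first column the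
normalized all-ones vector.  For all `A₂₂, A₂₁`:
`‖A₂₂ X₂ + A₂₁ 1ᴴ − Y₂‖_F² = (n+1)·‖A₂₂ μ_X + A₂₁ − μ_Y‖₂² + ‖(A₂₂ X₂ − Y₂) Q₂‖_F²`. -/
theorem stmt8 {p n : ℕ}
    (X2 Y2 : Matrix (Fin p) (Fin (n + 1)) ℂ)
    (μX μY : Fin p → ℂ)
    (hμX : ∀ i, μX i = (∑ j, X2 i j) / ((n : ℂ) + 1))
    (hμY : ∀ i, μY i = (∑ j, Y2 i j) / ((n : ℂ) + 1))
    (Q : Matrix (Fin (n + 1)) (Fin (n + 1)) ℂ)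
    (hQ : Q ∈ Matrix.unitaryGroup (Fin (n + 1)) ℂ)
    (hQ1 : ∀ i, Q i 0 = ((1 / Real.sqrt (n + 1) : ℝ) : ℂ))
    (Q2 : Matrix (Fin (n + 1)) (Fin n) ℂ)
    (hQ2 : ∀ i j, Q2 i j = Q i j.succ) :
    ∀ (A22 : Matrix (Fin p) (Fin p) ℂ) (A21 : Fin p → ℂ),
      frobSq (A22 * X2 + Matrix.of (fun i (_ : Fin (n + 1)) => A21 i) - Y2) =
        ((n : ℝ) + 1) * (∑ i, ‖(A22 *ᵥ μX + A21 - μY) i‖ ^ 2) +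
          frobSq ((A22 * X2 - Y2) * Q2) := by
  intro A22 A21
  have hr : (0 : ℝ) < n + 1 := by positivity
  have hs : 0 < Real.sqrt (n + 1) := Real.sqrt_pos.mpr hr
  have hn : (n : ℂ) + 1 ≠ 0 := by exact_mod_cast hr.ne'
  have hc : ((1 / Real.sqrt (n + 1) : ℝ) : ℂ) ≠ 0 := by
    exact_mod_cast (one_div_pos.mpr hs).ne'
  set M := A22 * X2 + Matrix.of (fun i (_ : Fin (n + 1)) => A21 i) - Y2 with hM
  have hmean : ∀ i, ∑ k, M i k = ((n : ℂ) + 1) * (A22 *ᵥ μX + A21 - μY) i := by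
    intro i
    have hX : ∑ k, (A22 * X2) i k = ((n : ℂ) + 1) * (A22 *ᵥ μX) i := by
      simp only [Matrix.mul_apply, Matrix.mulVec, dotProduct]
      rw [Finset.sum_comm, Finset.mul_sum]
      refine Finset.sum_congr rfl fun l _ => ?_
      rw [← Finset.mul_sum, hμX]
      field_simp
    have hY : ∑ k, Y2 i k = ((n : ℂ) + 1) * μY i := by
      rw [hμY]
      field_simp
    simp only [hM, Matrix.sub_apply, Matrix.add_apply, Matrix.of_apply,
      Finset.sum_sub_distrib, Finset.sum_add_distrib, hX, hY, Pi.sub_apply, Pi.add_apply]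
    simp
    ring
  have hfirst : ∀ i, ‖(M * Q) i 0‖ ^ 2 =
      ((n : ℝ) + 1) * ‖(A22 *ᵥ μX + A21 - μY) i‖ ^ 2 := by
    intro i
    have hnorm : ‖(n : ℂ) + 1‖ = (n : ℝ) + 1 := by
      exact_mod_cast Complex.norm_natCast (n + 1)
    simp only [Matrix.mul_apply, hQ1]
    rw [← Finset.sum_mul, hmean, norm_mul, norm_mul, hnorm, Complex.norm_real,
      Real.norm_of_nonneg (one_div_pos.mpr hs).le, mul_pow, mul_pow, div_pow,
      Real.sq_sqrt hr.le]
    field_simp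
  have hrest : ∀ i (j : Fin n), (M * Q) i j.succ = ((A22 * X2 - Y2) * Q2) i j := by
    intro i j
    have hsplit : M = (A22 * X2 - Y2) + Matrix.of (fun i (_ : Fin (n + 1)) => A21 i) := by
      rw [hM]
      abel
    rw [hsplit, Matrix.add_mul, Matrix.add_apply, Matrix.mul_apply (N := Q),
      Matrix.mul_apply (N := Q), Matrix.mul_apply (N := Q2)]
    simp only [Matrix.of_apply, hQ2,
      ← Finset.mul_sum, sum_column_succ_eq_zero hQ hc hQ1 j, mul_zero, add_zero]
  rw [← frobSq_mul_unitary M hQ]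
  simp only [frobSq, Fin.sum_univ_succ (n := n), hfirst, hrest, Finset.sum_add_distrib,
    Finset.mul_sum]
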